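/- Let g be odd with g ≥ 3, Γ the bounded part of the tropical hyperelliptic curve of genus g, and D* = ((g−1)/2)(V_0 + V_0′) + V_0. The tropical module 𝓜_g = { max( max_{0≤i≤3(g−1)/2}(a_{3(g−1)/2−i} + iX), max_{0≤i≤(g+1)/2}(b_i + iX + Y) ) : a_i, b_i ∈ ℝ ∪ {−∞} }, viewed as rational functions on Γ, is a proper subset of R(3D*). In particular, (i·x) + 3D* = i(V_g + V_g′) + (3(g+1)/2 − i)V_0 + (3(g−1)/2 − i)V_0′ is effective if and only if 0 ≤ i ≤ 3(g−1)/2, and (i·x + y) + 3D* = i(V_g + V_g′) + ((g+1)/2 − i)V_0 + ((5g−1)/2 − i)V_0′ is effective if and only if 0 ≤ i ≤ (g+1)/2. -/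

import Mathlib

open scoped BigOperators

namespace TropicalHyperelliptic

/-! ## The tropical hyperelliptic curve

For a genus `g ≥ 1` and parameters `c₋₁, c₀, …, c_{g+1}` (encoded as a function
`c : ℤ → ℝ`; only the values `c (-1), …, c (g+1)` matter), the tropical
polynomial `F̃(X,Y) = max(2Y, Y + P̃(X), c₋₁)` with
`P̃(X) = max_{0 ≤ i ≤ g+1} (c_i + iX)` defines the tropical hyperelliptic curve
`Γ̄` as the locus of points of `ℝ²` where `F̃` fails to be differentiable. -/

/-- The tropical polynomial `P̃(X) = max_{0 ≤ i ≤ g+1} (c_i + i X)`. -/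
noncomputable def Ptilde (g : ℕ) (c : ℤ → ℝ) (X : ℝ) : ℝ :=
  (Finset.range (g + 2)).sup' (Finset.nonempty_range_iff.mpr (by omega))
    fun i => c (i : ℤ) + (i : ℝ) * X

/-- The tropical polynomial `F̃(X,Y) = max(2Y, Y + P̃(X), c₋₁)`. -/
noncomputable def Ftilde (g : ℕ) (c : ℤ → ℝ) (P : ℝ × ℝ) : ℝ :=
  max (2 * P.2) (max (P.2 + Ptilde g c P.1) (c (-1)))

/-- The tropical hyperelliptic curve `Γ̄` of genus `g`: the set of points of
`ℝ²` at which `F̃` is not differentiable. -/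
def curveBar (g : ℕ) (c : ℤ → ℝ) : Set (ℝ × ℝ) :=
  {P | ¬ DifferentiableAt ℝ (Ftilde g c) P}

/-- The hypotheses on the parameters: `c_{g+1} = c_g = 0`, `c₋₁ < 2c₀`,
`cᵢ + c_{i+2} < 2c_{i+1}` for `0 ≤ i ≤ g − 2`, and `c_{g−1} < 2c_g = 0`.
Under these assumptions `Γ̄` is a smooth tropical curve of genus `g`. -/
def Hyp (g : ℕ) (c : ℤ → ℝ) : Prop :=
  c ((g : ℤ) + 1) = 0 ∧ c (g : ℤ) = 0 ∧ c (-1) < 2 * c 0 ∧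
  (∀ i : ℕ, (i : ℤ) ≤ (g : ℤ) - 2 → c i + c ((i : ℤ) + 2) < 2 * c ((i : ℤ) + 1)) ∧
  c ((g : ℤ) - 1) < 0

/-- The vertices `V_i` (`0 ≤ i ≤ g`) of `Γ̄` lying above the line
`Y = c₋₁/2`:  `V_0 = (0,0)` and
`V_i = (c_{g−i} − c_{g−i+1}, (g−i+1)c_{g−i} − (g−i)c_{g−i+1})`.
(The formula below also gives `V_0 = (0,0)` for `i = 0`, since
`c_g = c_{g+1} = 0`.) -/
noncomputable def V (g : ℕ) (c : ℤ → ℝ) (i : ℕ) : ℝ × ℝ :=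
  (c ((g : ℤ) - i) - c ((g : ℤ) - i + 1),
   (((g : ℤ) - i + 1 : ℤ) : ℝ) * c ((g : ℤ) - i)
     - (((g : ℤ) - i : ℤ) : ℝ) * c ((g : ℤ) - i + 1))

/-- The conjugate `P′` of a point `P`: the reflection with respect to the line
`Y = c₋₁/2`. -/
def conj (c : ℤ → ℝ) (P : ℝ × ℝ) : ℝ × ℝ := (P.1, c (-1) - P.2)

/-- The metric graph `Γ` obtained from `Γ̄` by removing all unbounded edges:
the part of `Γ̄` lying in the vertical strip `x(V_g) ≤ X ≤ x(V_0) = 0`,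
where `x(V_g) = c_0 − c_1`. -/
def Gam (g : ℕ) (c : ℤ → ℝ) : Set (ℝ × ℝ) :=
  {P ∈ curveBar g c | c 0 - c 1 ≤ P.1 ∧ P.1 ≤ 0}

/-! ## Rational functions, orders, and divisors -/

/-- The image in `ℝ²` of an integer vector. -/
def vr (v : ℤ × ℤ) : ℝ × ℝ := ((v.1 : ℝ), (v.2 : ℝ))

/-- The primitive integer directions along which one can leave the point `P`
inside the set `S` (the outgoing directions of the segments of `S` emanating
from `P`). -/
def localDirs (S : Set (ℝ × ℝ)) (P : ℝ × ℝ) : Set (ℤ × ℤ) :=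
  {v | IsCoprime v.1 v.2 ∧ ∃ ε > (0 : ℝ), ∀ t : ℝ, 0 < t → t < ε → P + t • vr v ∈ S}

/-- `f` has (integer) outgoing slope `s` at `P` in the direction `v` (slopes are
measured with respect to the lattice length). -/
def HasSlope (S : Set (ℝ × ℝ)) (f : ℝ × ℝ → ℝ) (P : ℝ × ℝ) (v : ℤ × ℤ) (s : ℤ) : Prop :=
  ∃ ε > (0 : ℝ), ∀ t : ℝ, 0 ≤ t → t < ε → P + t • vr v ∈ S →
    f (P + t • vr v) = f P + (s : ℝ) * t

/-- A rational function on (the tropical curve) `S ⊆ ℝ²`: a continuous function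
whose restriction to every edge is piecewise linear with integer slopes,
i.e. which has an integer outgoing slope at every point of `S` in every
outgoing direction. -/
structure IsRationalFn (S : Set (ℝ × ℝ)) (f : ℝ × ℝ → ℝ) : Prop where
  cont : ContinuousOn f S
  slope_int : ∀ P ∈ S, ∀ v ∈ localDirs S P, ∃ s : ℤ, HasSlope S f P v s

/-- The outgoing slope of `f` at `P` in the direction `v` (defaulting to `0`
when no integer slope exists). -/
noncomputable def slope (S : Set (ℝ × ℝ)) (f : ℝ × ℝ → ℝ) (P : ℝ × ℝ) (v : ℤ × ℤ) : ℤ :=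
  open scoped Classical in
  if h : ∃ s : ℤ, HasSlope S f P v s then h.choose else 0

/-- The order `ord_P f`: the sum of the outgoing slopes of `f` over all segments
of `S` emanating from `P`.  Points with `ord_P f > 0` are the zeros of `f`,
points with `ord_P f < 0` its poles. -/
noncomputable def ord (S : Set (ℝ × ℝ)) (f : ℝ × ℝ → ℝ) (P : ℝ × ℝ) : ℤ :=
  ∑ᶠ v ∈ localDirs S P, slope S f P v

/-- Divisors: formal `ℤ`-linear combinations of finitely many points of `ℝ²`. -/
abbrev Div := (ℝ × ℝ) →₀ ℤ

/-- The degree of a divisor: the sum of its coefficients. -/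
def deg (D : Div) : ℤ := D.sum fun _ n => n

/-- A divisor is effective (`D > 0`) when all its coefficients are nonnegative. -/
def Eff (D : Div) : Prop := ∀ P, 0 ≤ D P

/-- `R(D)`: the set of rational functions `f` on `S` with `(f) + D` effective. -/
def RSet (S : Set (ℝ × ℝ)) (D : Div) : Set ((ℝ × ℝ) → ℝ) :=
  {f | IsRationalFn S f ∧ ∀ P ∈ S, 0 ≤ ord S f P + D P}

/-- A divisor is principal when it is the divisor `(f) = Σ_P (ord_P f)·P` of a
rational function `f` on `S`. -/
def IsPrincipal (S : Set (ℝ × ℝ)) (D : Div) : Prop :=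
  ∃ f : (ℝ × ℝ) → ℝ, IsRationalFn S f ∧ ∀ P, D P = ord S f P

/-- Two divisors are (linearly) equivalent, `D ∼ D′`, when `D′ = D + (f)` for
some rational function `f` on `S`. -/
def LinEquiv (S : Set (ℝ × ℝ)) (D D' : Div) : Prop :=
  ∃ f : (ℝ × ℝ) → ℝ, IsRationalFn S f ∧ ∀ P, D' P = D P + ord S f P

end TropicalHyperelliptic

/-! ## The cycles `α_i` and the set `𝔇̃_g^+(Γ)` -/

namespace TropicalHyperelliptic

/-- The basis cycle `α_i` (`1 ≤ i ≤ g`) of the fundamental group `π₁(Γ)`: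
the cycle of `Γ` through the vertices `V_{i−1}`, `V_i` and their conjugates
`V_{i−1}′`, `V_i′`, i.e. the part of `Γ` in the vertical strip
`x(V_i) ≤ X ≤ x(V_{i−1})`. -/
def alphaCycle (g : ℕ) (c : ℤ → ℝ) (i : ℕ) : Set (ℝ × ℝ) :=
  {P ∈ Gam g c | (V g c i).1 ≤ P.1 ∧ P.1 ≤ (V g c (i - 1)).1}

/-- The overlap `α_{k,k+1} = (α_k ∩ α_{k+1}) ∖ {endpoints}` (`1 ≤ k ≤ g − 1`):
the open vertical edge of `Γ` joining `V_k` to `V_k′`.  (For non-adjacent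
indices the overlaps `α_i ∩ α_j` are empty.) -/
def alphaOpen (g : ℕ) (c : ℤ → ℝ) (k : ℕ) : Set (ℝ × ℝ) :=
  {P ∈ Gam g c | P.1 = (V g c k).1 ∧ P ≠ V g c k ∧ P ≠ conj c (V g c k)}

/-- The subset `𝔇̃_g^+(Γ)` of `𝔇_g^+(Γ)`: effective divisors
`P_1 + ⋯ + P_g` with `P_i ∈ α_i` for all `i`, such that each overlap `α_{ij}`
contains at most one of the points. -/
def Dtilde (g : ℕ) (c : ℤ → ℝ) : Set Div :=
  {D | ∃ Pt : Fin g → ℝ × ℝ,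
    (∀ i : Fin g, Pt i ∈ alphaCycle g c (i + 1)) ∧
    (∀ k : ℕ, 1 ≤ k → k ≤ g - 1 →
      ∀ i j : Fin g, Pt i ∈ alphaOpen g c k → Pt j ∈ alphaOpen g c k → i = j) ∧
    D = ∑ i : Fin g, Finsupp.single (Pt i) (1 : ℤ)}

/-- For even `g`, the base divisor `D* = (g/2)(V_0 + V_0′)`. -/
noncomputable def DstarEven (g : ℕ) (c : ℤ → ℝ) : Div :=
  ((g / 2 : ℕ) : ℤ) •
    (Finsupp.single (V g c 0) (1 : ℤ) + Finsupp.single (conj c (V g c 0)) (1 : ℤ))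

/-- For odd `g`, the base divisor `D* = ((g−1)/2)(V_0 + V_0′) + V_0`. -/
noncomputable def DstarOdd (g : ℕ) (c : ℤ → ℝ) : Div :=
  (((g - 1) / 2 : ℕ) : ℤ) •
    (Finsupp.single (V g c 0) (1 : ℤ) + Finsupp.single (conj c (V g c 0)) (1 : ℤ))
  + Finsupp.single (V g c 0) (1 : ℤ)

end TropicalHyperelliptic

namespace TropicalHyperelliptic

/-- For odd `g ≥ 3`, the tropical module `𝓜_g` spanned by the rational
functions `x^{⊗i}` (`0 ≤ i ≤ 3(g−1)/2`) and `x^{⊗i} ⊗ y`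
(`0 ≤ i ≤ (g+1)/2`): a function on `Γ` belongs to `𝓜_g` when it agrees on `Γ`
with `max( max_{0≤i≤3(g−1)/2}(a_i + iX), max_{0≤i≤(g+1)/2}(b_i + iX + Y) )`
for some coefficients `a_i, b_i ∈ 𝕋 = ℝ ∪ {−∞}`. -/
def InMgOdd (g : ℕ) (c : ℤ → ℝ) (f : (ℝ × ℝ) → ℝ) : Prop :=
  ∃ a b : ℕ → EReal, ∀ P ∈ Gam g c,
    (f P : EReal) =
      max ((Finset.range (3 * (g - 1) / 2 + 1)).sup
            fun i => a i + (((i : ℝ) * P.1 : ℝ) : EReal))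
          ((Finset.range ((g + 1) / 2 + 1)).sup
            fun i => b i + (((i : ℝ) * P.1 + P.2 : ℝ) : EReal))

end TropicalHyperelliptic

open TropicalHyperelliptic

/-! ## Helper material for the proof -/

namespace TropicalHyperelliptic

open Filter Topology

/-- Breakpoints of `Ptilde`. -/
def bk (c : ℤ → ℝ) (k : ℕ) : ℝ := c k - c ((k : ℤ) + 1)

lemma bk_succ {g : ℕ} {c : ℤ → ℝ} (hc : Hyp g c) {k : ℕ} (hk : k < g) : bk c k < bk c (k + 1) := by
  obtain ⟨h1, h2, h3, h4, h5⟩ := hc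
  unfold bk
  rcases Nat.lt_or_ge (k + 1) g with h | h
  · have := h4 k (by omega)
    push_cast
    rw [show (k : ℤ) + 1 + 1 = k + 2 by ring]
    linarith
  · have hk' : (k : ℤ) = (g : ℤ) - 1 := by omega
    push_cast
    rw [hk', show (g : ℤ) - 1 + 1 = g by ring]
    linarith

lemma bk_lt {g : ℕ} {c : ℤ → ℝ} (hc : Hyp g c) {j k : ℕ} (hjk : j < k) (hk : k ≤ g) :
    bk c j < bk c k := by
  induction k, hjk using Nat.le_induction with
  | base => exact bk_succ hc (by omega)
  | succ n hn ih => exact (ih (by omega)).trans (bk_succ hc (by omega))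

lemma bk_le {g : ℕ} {c : ℤ → ℝ} (hc : Hyp g c) {j k : ℕ} (hjk : j ≤ k) (hk : k ≤ g) :
    bk c j ≤ bk c k := by
  rcases hjk.eq_or_lt with h | h
  · rw [h]
  · exact (bk_lt hc h hk).le

lemma bk_g {g : ℕ} {c : ℤ → ℝ} (hc : Hyp g c) : bk c g = 0 := by
  unfold bk; rw [hc.1, hc.2.1]; simp

lemma U_eq {g : ℕ} {c : ℤ → ℝ} {k : ℕ} (hk : k ≤ g + 1) {X : ℝ}
    (h1 : ∀ j < k, bk c j ≤ X) (h2 : ∀ j, k ≤ j → j ≤ g → X ≤ bk c j) :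
    Ptilde g c X = c k + k * X := by
  unfold Ptilde
  apply le_antisymm
  · apply Finset.sup'_le
    intro i hi
    rw [Finset.mem_range] at hi
    rcases le_total k i with h | h
    · induction i, h using Nat.le_induction with
      | base => exact le_rfl
      | succ n hn ih =>
        have := ih (by omega)
        have h := h2 n hn (by omega)
        unfold bk at h
        push_cast
        linarith
    · induction h using Nat.decreasingInduction with
      | self => exact le_rfl
      | of_succ n hn ih =>
        have := ih (by omega)
        have h := h1 n hn
        unfold bk at h
        push_cast at this
        linarith
  · exact Finset.le_sup' (f := fun i : ℕ => c (i : ℤ) + (i : ℝ) * X)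
      (Finset.mem_range.mpr (by omega))

lemma U_cont (g : ℕ) (c : ℤ → ℝ) : Continuous (Ptilde g c) := by
  unfold Ptilde
  apply Continuous.finset_sup'_apply
  intro i _
  fun_prop

lemma U_pos {g : ℕ} {c : ℤ → ℝ} (hc : Hyp g c) (X : ℝ) : c (-1) < 2 * Ptilde g c X := by
  have h : c ((0 : ℕ) : ℤ) + ((0 : ℕ) : ℝ) * X ≤ Ptilde g c X :=
    Finset.le_sup' (f := fun i : ℕ => c (i : ℤ) + (i : ℝ) * X) (Finset.mem_range.mpr (by omega))
  have := hc.2.2.1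
  simp at h
  linarith

lemma U_bk {g : ℕ} {c : ℤ → ℝ} (hc : Hyp g c) {k : ℕ} (hk : k ≤ g) :
    Ptilde g c (bk c k) = c k + k * bk c k :=
  U_eq (by omega) (fun j hj => bk_le hc hj.le hk) (fun j hj hjg => bk_le hc hj hjg)

/-- Near a breakpoint, the other breakpoints are away. -/
lemma sep {g : ℕ} {c : ℤ → ℝ} (hc : Hyp g c) {k : ℕ} (hk : k ≤ g) :
    ∀ᶠ s in 𝓝 (0 : ℝ), ∀ j ≤ g, (j < k → bk c j < bk c k + s) ∧ (k < j → bk c k + s < bk c j) := by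
  have : ∀ᶠ s in 𝓝 (0 : ℝ), ∀ j ∈ Finset.range (g + 1),
      (j < k → bk c j < bk c k + s) ∧ (k < j → bk c k + s < bk c j) := by
    rw [Filter.eventually_all_finset]
    intro j hj
    rw [Finset.mem_range] at hj
    have hcont : Continuous fun s : ℝ => bk c k + s := by fun_prop
    refine Filter.Eventually.and ?_ ?_
    · by_cases h : j < k
      · have h0 : bk c j < bk c k + 0 := by rw [add_zero]; exact bk_lt hc h hk
        filter_upwards [hcont.continuousAt.eventually_const_lt h0] with s hs _ using hs
      · exact Filter.Eventually.of_forall fun s h' => absurd h' h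
    · by_cases h : k < j
      · have h0 : bk c k + 0 < bk c j := by rw [add_zero]; exact bk_lt hc h (by omega)
        filter_upwards [hcont.continuousAt.eventually_lt_const h0] with s hs _ using hs
      · exact Filter.Eventually.of_forall fun s h' => absurd h' h
  filter_upwards [this] with s hs j hj using hs j (Finset.mem_range.mpr (by omega))

lemma U_near {g : ℕ} {c : ℤ → ℝ} (hc : Hyp g c) {k : ℕ} (hk : k ≤ g) {s : ℝ}
    (hs : ∀ j ≤ g, (j < k → bk c j < bk c k + s) ∧ (k < j → bk c k + s < bk c j)) :
    (0 ≤ s → Ptilde g c (bk c k + s) = Ptilde g c (bk c k) + (k + 1) * s) ∧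
    (s ≤ 0 → Ptilde g c (bk c k + s) = Ptilde g c (bk c k) + k * s) := by
  rw [U_bk hc hk]
  constructor
  · intro h
    rw [U_eq (k := k + 1) (by omega)]
    · unfold bk; push_cast; ring
    · intro j hj
      have := bk_le hc (Nat.lt_succ_iff.mp hj) hk
      linarith
    · intro j hj hjg
      exact ((hs j hjg).2 (by omega)).le
  · intro h
    rw [U_eq (k := k) (by omega)]
    · ring
    · intro j hj
      exact ((hs j (by omega)).1 hj).le
    · intro j hj hjg
      have := bk_le hc hj hjg
      linarith

lemma strip_cases {g : ℕ} {c : ℤ → ℝ} {X : ℝ} (h0 : bk c 0 ≤ X) (h1 : X ≤ bk c g) :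
    (∃ k ≤ g, X = bk c k) ∨ ∃ k < g, bk c k < X ∧ X < bk c (k + 1) := by
  classical
  have hex : ∃ k, X ≤ bk c k := ⟨g, h1⟩
  have hm := Nat.find_spec hex
  have hle : Nat.find hex ≤ g := Nat.find_min' hex h1
  rcases hm.eq_or_lt with h | h
  · exact Or.inl ⟨_, hle, h⟩
  · rcases Nat.eq_zero_or_pos (Nat.find hex) with h' | h'
    · rw [h'] at h; exact absurd h0 (not_le.mpr h)
    · obtain ⟨n, hn⟩ := Nat.exists_eq_succ_of_ne_zero h'.ne'
      have hlt := Nat.find_min hex (m := n) (by omega)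
      rw [hn] at h
      exact Or.inr ⟨n, by omega, not_le.mp hlt, h⟩

lemma U_mid {g : ℕ} {c : ℤ → ℝ} (hc : Hyp g c) {k : ℕ} (hk : k < g) {X : ℝ}
    (h1 : bk c k ≤ X) (h2 : X ≤ bk c (k + 1)) :
    Ptilde g c X = c ((k + 1 : ℕ) : ℤ) + ((k + 1 : ℕ) : ℝ) * X := by
  apply U_eq (by omega)
  · intro j hj
    exact (bk_le hc (Nat.lt_succ_iff.mp hj) hk.le).trans h1
  · intro j hj hjg
    exact h2.trans (bk_le hc hj hjg)

lemma kink {F : ℝ × ℝ → ℝ} {P u : ℝ × ℝ} {a b : ℝ} (hab : a ≠ b)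
    (h1 : ∀ᶠ s in 𝓝 (0 : ℝ), 0 ≤ s → F (P + s • u) = F P + a * s)
    (h2 : ∀ᶠ s in 𝓝 (0 : ℝ), s ≤ 0 → F (P + s • u) = F P + b * s) :
    ¬ DifferentiableAt ℝ F P := by
  intro hF
  have hG : DifferentiableAt ℝ (fun s : ℝ => F (P + s • u)) 0 := by
    apply DifferentiableAt.comp (g := F)
    · simpa using hF
    · fun_prop
  have hd := hG.hasDerivAt
  have e1 : HasDerivWithinAt (fun s : ℝ => F (P + s • u)) a (Set.Ici 0) 0 := by
    have : HasDerivWithinAt (fun s : ℝ => F P + a * s) a (Set.Ici 0) 0 := by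
      simpa using (((hasDerivAt_id (0 : ℝ)).const_mul a).const_add (F P)).hasDerivWithinAt
    refine this.congr_of_eventuallyEq ?_ (by simp)
    filter_upwards [self_mem_nhdsWithin, nhdsWithin_le_nhds h1] with s hs hs' using hs' hs
  have e2 : HasDerivWithinAt (fun s : ℝ => F (P + s • u)) b (Set.Iic 0) 0 := by
    have : HasDerivWithinAt (fun s : ℝ => F P + b * s) b (Set.Iic 0) 0 := by
      simpa using (((hasDerivAt_id (0 : ℝ)).const_mul b).const_add (F P)).hasDerivWithinAt
    refine this.congr_of_eventuallyEq ?_ (by simp)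
    filter_upwards [self_mem_nhdsWithin, nhdsWithin_le_nhds h2] with s hs hs' using hs' hs
  have u1 := (uniqueDiffOn_Ici (0 : ℝ) 0 Set.self_mem_Ici).eq_deriv _ e1 hd.hasDerivWithinAt
  have u2 := (uniqueDiffOn_Iic (0 : ℝ) 0 Set.self_mem_Iic).eq_deriv _ e2 hd.hasDerivWithinAt
  exact hab (u1.trans u2.symm)

lemma F_mid {g : ℕ} {c : ℤ → ℝ} {P : ℝ × ℝ} (h1 : c (-1) - Ptilde g c P.1 ≤ P.2)
    (h2 : P.2 ≤ Ptilde g c P.1) : Ftilde g c P = P.2 + Ptilde g c P.1 := by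
  unfold Ftilde
  rw [max_eq_left (a := P.2 + Ptilde g c P.1) (by linarith), max_eq_right (by linarith)]

lemma F_up {g : ℕ} {c : ℤ → ℝ} (hc : Hyp g c) {P : ℝ × ℝ}
    (h2 : Ptilde g c P.1 ≤ P.2) : Ftilde g c P = 2 * P.2 := by
  have := U_pos hc P.1
  unfold Ftilde
  rw [max_eq_left]
  apply max_le <;> linarith

lemma F_low {g : ℕ} {c : ℤ → ℝ} (hc : Hyp g c) {P : ℝ × ℝ}
    (h2 : P.2 ≤ c (-1) - Ptilde g c P.1) : Ftilde g c P = c (-1) := by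
  have := U_pos hc P.1
  unfold Ftilde
  rw [max_eq_right, max_eq_right]
  · linarith
  · rw [le_max_iff]; right; linarith

lemma mem_Gam {g : ℕ} {c : ℤ → ℝ} (hc : Hyp g c) (P : ℝ × ℝ) :
    P ∈ Gam g c ↔ (bk c 0 ≤ P.1 ∧ P.1 ≤ bk c g) ∧
      (P.2 = Ptilde g c P.1 ∨ P.2 = c (-1) - Ptilde g c P.1 ∨
        ((∃ k ≤ g, P.1 = bk c k) ∧ c (-1) - Ptilde g c P.1 ≤ P.2 ∧ P.2 ≤ Ptilde g c P.1)) := by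
  have hb0 : c 0 - c 1 = bk c 0 := by simp [bk]
  unfold Gam curveBar
  rw [Set.mem_sep_iff, hb0, bk_g hc, Set.mem_ofPred_eq, and_comm]
  refine and_congr_right fun hstrip => ?_
  have hUc := U_cont g c
  have hc1 : Continuous fun Q : ℝ × ℝ => Ptilde g c Q.1 := by fun_prop
  have hU := U_pos hc P.1
  constructor
  · intro hnd
    by_contra hcon
    push Not at hcon
    obtain ⟨n1, n2, n3⟩ := hcon
    apply hnd
    rcases lt_or_gt_of_ne n1 with h | h
    · rcases lt_or_gt_of_ne n2 with h' | h'
      · have ev : ∀ᶠ Q in 𝓝 P, Q.2 < c (-1) - Ptilde g c Q.1 :=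
          (isOpen_lt continuous_snd (by fun_prop)).mem_nhds h'
        refine (differentiableAt_const (c (-1))).congr_of_eventuallyEq ?_
        filter_upwards [ev] with Q hQ using F_low hc hQ.le
      · have hnb : ¬ ∃ k ≤ g, P.1 = bk c k := by
          intro hk
          have := n3 hk h'.le
          linarith
        rcases strip_cases hstrip.1 (by rw [bk_g hc]; exact hstrip.2) with hk | ⟨k, hk, hk1, hk2⟩
        · exact absurd hk hnb
        have ev1 : ∀ᶠ Q in 𝓝 P, c (-1) - Ptilde g c Q.1 < Q.2 :=
          (isOpen_lt (by fun_prop) continuous_snd).mem_nhds h'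
        have ev2 : ∀ᶠ Q in 𝓝 P, Q.2 < Ptilde g c Q.1 :=
          (isOpen_lt continuous_snd (by fun_prop)).mem_nhds h
        have ev3 : ∀ᶠ Q in 𝓝 P, bk c k < Q.1 :=
          (isOpen_lt continuous_const continuous_fst).mem_nhds hk1
        have ev4 : ∀ᶠ Q in 𝓝 P, Q.1 < bk c (k + 1) :=
          (isOpen_lt continuous_fst continuous_const).mem_nhds hk2
        have hd : DifferentiableAt ℝ (fun Q : ℝ × ℝ =>
          Q.2 + (c ((k + 1 : ℕ) : ℤ) + ((k + 1 : ℕ) : ℝ) * Q.1)) P := by fun_prop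
        refine hd.congr_of_eventuallyEq ?_
        filter_upwards [ev1, ev2, ev3, ev4] with Q q1 q2 q3 q4
        rw [F_mid q1.le q2.le, U_mid hc hk q3.le q4.le]
    · have ev : ∀ᶠ Q in 𝓝 P, Ptilde g c Q.1 < Q.2 :=
        (isOpen_lt (by fun_prop) continuous_snd).mem_nhds h
      have hd : DifferentiableAt ℝ (fun Q : ℝ × ℝ => 2 * Q.2) P := by fun_prop
      refine hd.congr_of_eventuallyEq ?_
      filter_upwards [ev] with Q hQ using F_up hc hQ.le
  · have up : P.2 = Ptilde g c P.1 → ¬ DifferentiableAt ℝ (Ftilde g c) P := by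
      intro h
      refine kink (u := (0, 1)) (a := 2) (b := 1) (by norm_num) ?_ ?_
      · refine Filter.Eventually.of_forall fun s hs => ?_
        rw [F_up hc h.ge, F_up hc] <;> simp
        · ring
        · linarith
      · have ev : ∀ᶠ s in 𝓝 (0 : ℝ), c (-1) - 2 * Ptilde g c P.1 < s :=
          lt_mem_nhds (by linarith)
        filter_upwards [ev] with s hs hs0
        rw [F_up hc h.ge, F_mid] <;> simp <;> linarith
    have low : P.2 = c (-1) - Ptilde g c P.1 → ¬ DifferentiableAt ℝ (Ftilde g c) P := by
      intro h
      refine kink (u := (0, 1)) (a := 1) (b := 0) (by norm_num) ?_ ?_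
      · have ev : ∀ᶠ s in 𝓝 (0 : ℝ), s < 2 * Ptilde g c P.1 - c (-1) :=
          gt_mem_nhds (by linarith)
        filter_upwards [ev] with s hs hs0
        rw [F_low hc h.le, F_mid] <;> simp <;> linarith
      · refine Filter.Eventually.of_forall fun s hs => ?_
        rw [F_low hc h.le, F_low hc] <;> simp
        linarith
    rintro (h | h | ⟨⟨k, hk, hX⟩, h1, h2⟩)
    · exact up h
    · exact low h
    · rcases h2.eq_or_lt with h2' | h2'
      · exact up h2'
      rcases h1.eq_or_lt with h1' | h1'
      · exact low h1'.symm
      have ev1 : ∀ᶠ s in 𝓝 (0 : ℝ), c (-1) - Ptilde g c (P.1 + s) < P.2 :=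
        (isOpen_lt (by fun_prop) continuous_const).mem_nhds (by simpa using h1')
      have ev2 : ∀ᶠ s in 𝓝 (0 : ℝ), P.2 < Ptilde g c (P.1 + s) :=
        (isOpen_lt continuous_const (by fun_prop)).mem_nhds (by simpa using h2')
      refine kink (u := (1, 0)) (a := k + 1) (b := k) (by simp) ?_ ?_
      · filter_upwards [ev1, ev2, sep hc hk] with s s1 s2 s3 s0
        rw [F_mid h1 h2, F_mid] <;> simp
        · rw [hX, (U_near hc hk s3).1 s0]; ring
        · linarith
        · linarith
      · filter_upwards [ev1, ev2, sep hc hk] with s s1 s2 s3 s0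
        rw [F_mid h1 h2, F_mid] <;> simp
        · rw [hX, (U_near hc hk s3).2 s0]; ring
        · linarith
        · linarith

end TropicalHyperelliptic

namespace TropicalHyperelliptic

open Filter Topology

/-- Near `P`, the set `S` is the cone `M` translated to `P`. -/
def LocalModel (S : Set (ℝ × ℝ)) (P : ℝ × ℝ) (M : ℝ × ℝ → Prop) : Prop :=
  (∀ᶠ w in 𝓝 (0 : ℝ × ℝ), (P + w ∈ S ↔ M w)) ∧ ∀ t : ℝ, 0 < t → ∀ w, M (t • w) ↔ M w

lemma localDirs_eq {S : Set (ℝ × ℝ)} {P : ℝ × ℝ} {M : ℝ × ℝ → Prop} (h : LocalModel S P M) :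
    localDirs S P = {v | IsCoprime v.1 v.2 ∧ M (vr v)} := by
  ext v
  have ht : Tendsto (fun t : ℝ => t • vr v) (𝓝 0) (𝓝 0) := by
    have : Continuous fun t : ℝ => t • vr v := by fun_prop
    simpa using this.tendsto 0
  obtain ⟨δ, hδ, hb⟩ := Metric.eventually_nhds_iff.mp (ht.eventually h.1)
  have hb' : ∀ t : ℝ, 0 < t → t < δ → (P + t • vr v ∈ S ↔ M (vr v)) := by
    intro t h0 h1
    rw [hb (by rw [Real.dist_eq, sub_zero, abs_of_pos h0]; exact h1), h.2 t h0]
  refine and_congr_right fun _ => ?_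
  constructor
  · rintro ⟨ε, hε, hS⟩
    have hm : 0 < min ε δ / 2 := by positivity
    have h1 : min ε δ / 2 < ε := by have := min_le_left ε δ; linarith
    have h2 : min ε δ / 2 < δ := by have := min_le_right ε δ; linarith
    exact (hb' _ hm h2).mp (hS _ hm h1)
  · intro hM
    exact ⟨δ, hδ, fun t h0 h1 => (hb' t h0 h1).mpr hM⟩

/-- The outgoing directions are finitely many, with sum `(A, B)`. -/
def KK (S : Set (ℝ × ℝ)) (P : ℝ × ℝ) (A B : ℤ) : Prop :=
  (localDirs S P).Finite ∧ ∑ᶠ v ∈ localDirs S P, v.1 = A ∧ ∑ᶠ v ∈ localDirs S P, v.2 = B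

lemma KK_of_finset {S : Set (ℝ × ℝ)} {P : ℝ × ℝ} (s : Finset (ℤ × ℤ)) (h : localDirs S P = ↑s) :
    KK S P (∑ v ∈ s, v.1) (∑ v ∈ s, v.2) := by
  unfold KK
  rw [h]
  exact ⟨s.finite_toSet, finsum_mem_coe_finset _ s, finsum_mem_coe_finset _ s⟩

lemma conj_conj (c : ℤ → ℝ) (P : ℝ × ℝ) : conj c (conj c P) = P := by
  ext <;> simp [conj]

lemma conj_mem {g : ℕ} {c : ℤ → ℝ} (hc : Hyp g c) {P : ℝ × ℝ} (h : P ∈ Gam g c) :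
    conj c P ∈ Gam g c := by
  rw [mem_Gam hc] at h ⊢
  obtain ⟨h0, h⟩ := h
  refine ⟨h0, ?_⟩
  simp only [conj]
  rcases h with h | h | ⟨h1, h2, h3⟩
  · right; left; rw [h]
  · left; rw [h]; ring
  · right; right; exact ⟨h1, by linarith, by linarith⟩

lemma conj_mem_iff {g : ℕ} {c : ℤ → ℝ} (hc : Hyp g c) {P : ℝ × ℝ} :
    conj c P ∈ Gam g c ↔ P ∈ Gam g c :=
  ⟨fun h => by simpa [conj_conj] using conj_mem hc h, conj_mem hc⟩

lemma localDirs_conj {g : ℕ} {c : ℤ → ℝ} (hc : Hyp g c) (P : ℝ × ℝ) (v : ℤ × ℤ) :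
    v ∈ localDirs (Gam g c) (conj c P) ↔ (v.1, -v.2) ∈ localDirs (Gam g c) P := by
  unfold localDirs
  have key : ∀ t : ℝ, conj c P + t • vr v = conj c (P + t • vr (v.1, -v.2)) := by
    intro t
    ext
    · simp [conj, vr]
    · simp [conj, vr]; ring
  simp only [Set.mem_ofPred_eq, IsCoprime.neg_right_iff, key, conj_mem_iff hc]

lemma KK_conj {g : ℕ} {c : ℤ → ℝ} (hc : Hyp g c) {P : ℝ × ℝ} {A B : ℤ}
    (h : KK (Gam g c) P A B) : KK (Gam g c) (conj c P) A (-B) := by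
  obtain ⟨h1, h2, h3⟩ := h
  have him : localDirs (Gam g c) (conj c P) =
      (fun v : ℤ × ℤ => (v.1, -v.2)) '' localDirs (Gam g c) P := by
    ext v
    rw [localDirs_conj hc]
    constructor
    · intro hv
      exact ⟨_, hv, by simp⟩
    · rintro ⟨u, hu, rfl⟩
      simpa using hu
  have hinj : Function.Injective (fun v : ℤ × ℤ => (v.1, -v.2)) := by
    intro u v huv
    simp only [Prod.mk.injEq, neg_inj] at huv
    exact Prod.ext huv.1 huv.2
  unfold KK
  rw [him]
  refine ⟨h1.image _, ?_, ?_⟩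
  · rw [finsum_mem_image hinj.injOn]; exact h2
  · rw [finsum_mem_image hinj.injOn]
    simp only
    rw [finsum_mem_neg_distrib _ h1, h3]

lemma coprime_mul_left' {a k : ℤ} (h : IsCoprime a (k * a)) : a = 1 ∨ a = -1 := by
  have : IsUnit a := h.isUnit_of_dvd' dvd_rfl (Dvd.intro_left k rfl)
  exact Int.isUnit_iff.mp this

lemma KK_line {S : Set (ℝ × ℝ)} {P : ℝ × ℝ} (k : ℤ)
    (h : LocalModel S P (fun w => w.2 = k * w.1)) : KK S P 0 0 := by
  have := KK_of_finset (S := S) (P := P) {(1, k), (-1, -k)} (by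
    rw [localDirs_eq h]
    ext ⟨a, b⟩
    simp only [vr, Set.mem_ofPred_eq, Finset.coe_insert, Finset.coe_singleton,
      Set.mem_insert_iff, Set.mem_singleton_iff, Prod.mk.injEq]
    constructor
    · rintro ⟨h1, h2⟩
      have h2 : b = k * a := by exact_mod_cast h2
      subst h2
      rcases coprime_mul_left' h1 with rfl | rfl <;> simp
    · rintro (⟨rfl, rfl⟩ | ⟨rfl, rfl⟩)
      · exact ⟨isCoprime_one_left, by simp⟩
      · exact ⟨isCoprime_one_left.neg_left, by simp⟩)
  rw [Finset.sum_pair (by simp), Finset.sum_pair (by simp)] at this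
  simpa using this

lemma KK_vert {S : Set (ℝ × ℝ)} {P : ℝ × ℝ}
    (h : LocalModel S P (fun w => w.1 = 0)) : KK S P 0 0 := by
  have := KK_of_finset (S := S) (P := P) {(0, 1), (0, -1)} (by
    rw [localDirs_eq h]
    ext ⟨a, b⟩
    simp only [vr, Set.mem_ofPred_eq, Finset.coe_insert, Finset.coe_singleton,
      Set.mem_insert_iff, Set.mem_singleton_iff, Prod.mk.injEq]
    constructor
    · rintro ⟨h1, h2⟩
      have h2 : a = 0 := by exact_mod_cast h2
      subst h2
      rw [isCoprime_zero_left, Int.isUnit_iff] at h1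
      simpa using h1
    · rintro (⟨rfl, rfl⟩ | ⟨rfl, rfl⟩) <;> simp [isCoprime_zero_left])
  rw [Finset.sum_pair (by simp), Finset.sum_pair (by simp)] at this
  simpa using this

/-- The local cone at the vertex with index `k`. -/
def vmod (g k : ℕ) (w : ℝ × ℝ) : Prop :=
  (w.1 = 0 ∧ w.2 ≤ 0) ∨ (0 < w.1 ∧ k < g ∧ w.2 = (k + 1) * w.1) ∨
    (w.1 < 0 ∧ 0 < k ∧ w.2 = k * w.1)

lemma vmod_dirs (g k : ℕ) (v : ℤ × ℤ) : (IsCoprime v.1 v.2 ∧ vmod g k (vr v)) ↔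
    v = (0, -1) ∨ (k < g ∧ v = (1, (k : ℤ) + 1)) ∨ (0 < k ∧ v = (-1, -(k : ℤ))) := by
  obtain ⟨a, b⟩ := v
  simp only [vr, vmod, Prod.mk.injEq]
  constructor
  · rintro ⟨h1, ⟨h2, h3⟩ | ⟨h2, h3, h4⟩ | ⟨h2, h3, h4⟩⟩
    · have h2 : a = 0 := by exact_mod_cast h2
      subst h2
      rw [isCoprime_zero_left, Int.isUnit_iff] at h1
      have h3 : b ≤ 0 := by exact_mod_cast h3
      left; omega
    · have h4 : b = ((k : ℤ) + 1) * a := by exact_mod_cast h4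
      subst h4
      have h2 : 0 < a := by exact_mod_cast h2
      rcases coprime_mul_left' h1 with rfl | rfl
      · right; left; exact ⟨h3, rfl, by ring⟩
      · omega
    · have h4 : b = (k : ℤ) * a := by exact_mod_cast h4
      subst h4
      have h2 : a < 0 := by exact_mod_cast h2
      rcases coprime_mul_left' h1 with rfl | rfl
      · omega
      · right; right; exact ⟨h3, rfl, by ring⟩
  · rintro (⟨rfl, rfl⟩ | ⟨h, rfl, rfl⟩ | ⟨h, rfl, rfl⟩)
    · simp [isCoprime_zero_left]
    · refine ⟨isCoprime_one_left, Or.inr (Or.inl ⟨by simp, h, by simp⟩)⟩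
    · refine ⟨isCoprime_one_left.neg_left, Or.inr (Or.inr ⟨by simp, h, by simp⟩)⟩

lemma KK_vertex {S : Set (ℝ × ℝ)} {P : ℝ × ℝ} {g k : ℕ} (hk : k ≤ g) (hg : 0 < g)
    (h : LocalModel S P (vmod g k)) :
    KK S P ((if k = 0 then 1 else 0) - (if k = g then 1 else 0))
      (if k = g then -((g : ℤ) + 1) else 0) := by
  have hd : ∀ v, v ∈ localDirs S P ↔
      v = (0, -1) ∨ (k < g ∧ v = (1, (k : ℤ) + 1)) ∨ (0 < k ∧ v = (-1, -(k : ℤ))) := by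
    intro v
    rw [localDirs_eq h, ← vmod_dirs]
    rfl
  rcases Nat.eq_zero_or_pos k with rfl | hk0
  · have := KK_of_finset (S := S) (P := P) {(0, -1), (1, 1)} (by
      ext v; rw [hd]; simp [hg])
    rw [Finset.sum_pair (by simp), Finset.sum_pair (by simp)] at this
    simpa [hg.ne] using this
  rcases hk.eq_or_lt with rfl | hk1
  · have := KK_of_finset (S := S) (P := P) {(0, -1), (-1, -(k : ℤ))} (by
      ext v; rw [hd]; simp [hg])
    rw [Finset.sum_pair (by simp), Finset.sum_pair (by simp)] at this
    simpa [hk0.ne', add_comm] using this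
  · have := KK_of_finset (S := S) (P := P) {(0, -1), (1, (k : ℤ) + 1), (-1, -(k : ℤ))} (by
      ext v; rw [hd]; simp [hk0, hk1])
    rw [Finset.sum_insert (by simp), Finset.sum_pair (by simp), Finset.sum_insert (by simp),
      Finset.sum_pair (by simp)] at this
    simpa [hk0.ne', hk1.ne] using this

lemma vmod_cone (g k : ℕ) (t : ℝ) (ht : 0 < t) (w : ℝ × ℝ) : vmod g k (t • w) ↔ vmod g k w := by
  have e1 : t * w.1 = 0 ↔ w.1 = 0 := by simp [ht.ne']
  have e2 : t * w.2 ≤ 0 ↔ w.2 ≤ 0 := by rw [← not_lt, ← not_lt, mul_pos_iff_of_pos_left ht]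
  have e3 : 0 < t * w.1 ↔ 0 < w.1 := mul_pos_iff_of_pos_left ht
  have e4 : t * w.1 < 0 ↔ w.1 < 0 := by rw [← not_le, ← not_le, mul_nonneg_iff_of_pos_left ht]
  have e5 : ∀ r : ℝ, t * w.2 = r * (t * w.1) ↔ w.2 = r * w.1 := by
    intro r
    rw [show r * (t * w.1) = t * (r * w.1) by ring]
    exact mul_right_inj' ht.ne'
  simp only [vmod, Prod.smul_fst, Prod.smul_snd, smul_eq_mul, e1, e2, e3, e4, e5]

/-- Vertices. -/
noncomputable def W (g : ℕ) (c : ℤ → ℝ) (k : ℕ) : ℝ × ℝ := (bk c k, Ptilde g c (bk c k))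

lemma ev_fst {p : ℝ → Prop} (h : ∀ᶠ s in 𝓝 (0 : ℝ), p s) : ∀ᶠ w in 𝓝 (0 : ℝ × ℝ), p w.1 :=
  (continuous_fst.tendsto (0 : ℝ × ℝ)).eventually h

lemma KK_W {g : ℕ} {c : ℤ → ℝ} (hc : Hyp g c) (hg : 0 < g) {k : ℕ} (hk : k ≤ g) :
    KK (Gam g c) (W g c k) ((if k = 0 then 1 else 0) - (if k = g then 1 else 0))
      (if k = g then -((g : ℤ) + 1) else 0) := by
  apply KK_vertex hk hg
  refine ⟨?_, vmod_cone g k⟩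
  have hUc := U_cont g c
  have ev1 : ∀ᶠ w in 𝓝 (0 : ℝ × ℝ),
      c (-1) - Ptilde g c (bk c k + w.1) < Ptilde g c (bk c k) + w.2 := by
    refine (isOpen_lt (by fun_prop) (by fun_prop)).mem_nhds ?_
    have := U_pos hc (bk c k)
    simp
    linarith
  filter_upwards [ev1, ev_fst (sep hc hk)] with w h1 hs
  have hU := U_near hc hk hs
  rw [mem_Gam hc]
  simp only [W, Prod.fst_add, Prod.snd_add, vmod]
  have hlo : bk c 0 ≤ bk c k := bk_le hc (Nat.zero_le _) hk
  have hhi : bk c k ≤ bk c g := bk_le hc hk le_rfl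
  have nobk : w.1 ≠ 0 → ¬ ∃ j ≤ g, bk c k + w.1 = bk c j := by
    rintro hw ⟨j, hj, he⟩
    rcases lt_trichotomy j k with h | h | h
    · have := (hs j hj).1 h; linarith
    · subst h; apply hw; linarith
    · have := (hs j hj).2 h; linarith
  rcases lt_trichotomy w.1 0 with hw | hw | hw
  · rw [hU.2 hw.le] at h1 ⊢
    constructor
    · rintro ⟨⟨s1, s2⟩, h | h | ⟨h, -⟩⟩
      · right; right
        refine ⟨hw, ?_, by linarith⟩
        rcases Nat.eq_zero_or_pos k with rfl | h'
        · linarith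
        · exact h'
      · linarith
      · exact absurd h (nobk hw.ne)
    · rintro (⟨h, -⟩ | ⟨h, -⟩ | ⟨-, hk0, h⟩)
      · linarith
      · linarith
      · exact ⟨⟨((hs 0 (by omega)).1 hk0).le, by linarith⟩, Or.inl (by linarith)⟩
  · rw [hw] at h1 ⊢
    simp only [add_zero] at h1 ⊢
    constructor
    · rintro ⟨-, h | h | ⟨-, -, h⟩⟩
      · left; exact ⟨trivial, by linarith⟩
      · linarith
      · left; exact ⟨trivial, by linarith⟩
    · rintro (⟨-, h⟩ | ⟨h, -⟩ | ⟨h, -⟩)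
      · exact ⟨⟨hlo, hhi⟩, Or.inr (Or.inr ⟨⟨k, hk, rfl⟩, h1.le, by linarith⟩)⟩
      · exact absurd h (lt_irrefl _)
      · exact absurd h (lt_irrefl _)
  · rw [hU.1 hw.le] at h1 ⊢
    constructor
    · rintro ⟨⟨s1, s2⟩, h | h | ⟨h, -⟩⟩
      · right; left
        refine ⟨hw, ?_, by linarith⟩
        rcases hk.eq_or_lt with rfl | h'
        · linarith
        · exact h'
      · linarith
      · exact absurd h (nobk hw.ne')
    · rintro (⟨h, -⟩ | ⟨-, hk0, h⟩ | ⟨h, -⟩)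
      · linarith
      · exact ⟨⟨by linarith, ((hs g le_rfl).2 hk0).le⟩, Or.inl (by linarith)⟩
      · linarith

lemma KK_vertical {g : ℕ} {c : ℤ → ℝ} (hc : Hyp g c) {k : ℕ} (hk : k ≤ g) {P : ℝ × ℝ}
    (hX : P.1 = bk c k) (h1 : c (-1) - Ptilde g c P.1 < P.2) (h2 : P.2 < Ptilde g c P.1) :
    KK (Gam g c) P 0 0 := by
  apply KK_vert
  refine ⟨?_, fun t ht w => by simp [ht.ne']⟩
  have hUc := U_cont g c
  have ev1 : ∀ᶠ w in 𝓝 (0 : ℝ × ℝ), c (-1) - Ptilde g c (P.1 + w.1) < P.2 + w.2 :=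
    (isOpen_lt (by fun_prop) (by fun_prop)).mem_nhds (by simpa using h1)
  have ev2 : ∀ᶠ w in 𝓝 (0 : ℝ × ℝ), P.2 + w.2 < Ptilde g c (P.1 + w.1) :=
    (isOpen_lt (by fun_prop) (by fun_prop)).mem_nhds (by simpa using h2)
  filter_upwards [ev1, ev2, ev_fst (sep hc hk)] with w e1 e2 hs
  rw [mem_Gam hc]
  simp only [Prod.fst_add, Prod.snd_add]
  constructor
  · rintro ⟨-, h | h | ⟨⟨j, hj, he⟩, -⟩⟩
    · linarith
    · linarith
    · rw [hX] at he
      rcases lt_trichotomy j k with h | h | h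
      · have := (hs j hj).1 h; linarith
      · subst h; linarith
      · have := (hs j hj).2 h; linarith
  · intro hw
    rw [hw, hX, add_zero] at e1 e2 ⊢
    exact ⟨⟨bk_le hc (Nat.zero_le _) hk, bk_le hc hk le_rfl⟩,
      Or.inr (Or.inr ⟨⟨k, hk, rfl⟩, e1.le, e2.le⟩)⟩

lemma KK_edge {g : ℕ} {c : ℤ → ℝ} (hc : Hyp g c) {k : ℕ} (hk : k < g) {P : ℝ × ℝ}
    (hX1 : bk c k < P.1) (hX2 : P.1 < bk c (k + 1)) (h : P.2 = Ptilde g c P.1) :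
    KK (Gam g c) P 0 0 := by
  apply KK_line ((k + 1 : ℕ) : ℤ)
  refine ⟨?_, fun t ht w => ?_⟩
  swap
  · simp only [Prod.smul_fst, Prod.smul_snd, smul_eq_mul]
    rw [mul_left_comm]
    exact mul_right_inj' ht.ne'
  have hUc := U_cont g c
  have hU := U_pos hc P.1
  have ev1 : ∀ᶠ w in 𝓝 (0 : ℝ × ℝ), c (-1) - Ptilde g c (P.1 + w.1) < P.2 + w.2 := by
    refine (isOpen_lt (by fun_prop) (by fun_prop)).mem_nhds ?_
    simp
    linarith
  have ev2 : ∀ᶠ w in 𝓝 (0 : ℝ × ℝ), bk c k < P.1 + w.1 :=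
    (isOpen_lt (by fun_prop) (by fun_prop)).mem_nhds (by simpa using hX1)
  have ev3 : ∀ᶠ w in 𝓝 (0 : ℝ × ℝ), P.1 + w.1 < bk c (k + 1) :=
    (isOpen_lt (by fun_prop) (by fun_prop)).mem_nhds (by simpa using hX2)
  filter_upwards [ev1, ev2, ev3] with w e1 e2 e3
  have u1 := U_mid hc hk hX1.le hX2.le
  have u2 := U_mid hc hk e2.le e3.le
  rw [mem_Gam hc]
  simp only [Prod.fst_add, Prod.snd_add]
  have hlo : bk c 0 ≤ bk c k := bk_le hc (Nat.zero_le _) hk.le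
  have hhi : bk c (k + 1) ≤ bk c g := bk_le hc hk le_rfl
  constructor
  · rintro ⟨-, h' | h' | ⟨⟨j, hj, he⟩, -⟩⟩
    · rw [u2, h, u1] at h'
      push_cast at h' ⊢
      linarith
    · linarith
    · exfalso
      rcases Nat.lt_or_ge k j with hjk | hjk
      · have := bk_le hc hjk hj; linarith
      · have := bk_le hc hjk hk.le; linarith
  · intro hw
    refine ⟨⟨by linarith, by linarith⟩, Or.inl ?_⟩
    rw [u2, h, u1, hw]
    push_cast
    ring

lemma isClosed_or' {p q : ℝ × ℝ → Prop} (hp : IsClosed {x | p x}) (hq : IsClosed {x | q x}) :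
    IsClosed {x | p x ∨ q x} := by
  have : {x | p x ∨ q x} = {x | p x} ∪ {x | q x} := by ext; simp
  rw [this]
  exact hp.union hq

lemma Gam_closed {g : ℕ} {c : ℤ → ℝ} (hc : Hyp g c) : IsClosed (Gam g c) := by
  have hUc := U_cont g c
  have : Gam g c = {P : ℝ × ℝ | (bk c 0 ≤ P.1 ∧ P.1 ≤ bk c g) ∧
      (P.2 = Ptilde g c P.1 ∨ P.2 = c (-1) - Ptilde g c P.1 ∨
        ((∃ k ≤ g, P.1 = bk c k) ∧ c (-1) - Ptilde g c P.1 ≤ P.2 ∧ P.2 ≤ Ptilde g c P.1))} := by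
    ext P; exact mem_Gam hc P
  rw [this]
  have hfin : IsClosed {P : ℝ × ℝ | ∃ k ≤ g, P.1 = bk c k} := by
    have : {P : ℝ × ℝ | ∃ k ≤ g, P.1 = bk c k} = ⋃ k ∈ Set.Iic g, {P : ℝ × ℝ | P.1 = bk c k} := by
      ext P; simp
    rw [this]
    exact (Set.finite_Iic g).isClosed_biUnion
      fun k _ => isClosed_eq continuous_fst continuous_const
  refine IsClosed.and (IsClosed.and ?_ ?_) (isClosed_or' ?_ (isClosed_or' ?_ (hfin.and (IsClosed.and ?_ ?_))))
  · exact isClosed_le (by fun_prop) (by fun_prop)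
  · exact isClosed_le (by fun_prop) (by fun_prop)
  · exact isClosed_eq (by fun_prop) (by fun_prop)
  · exact isClosed_eq (by fun_prop) (by fun_prop)
  · exact isClosed_le (by fun_prop) (by fun_prop)
  · exact isClosed_le (by fun_prop) (by fun_prop)

lemma KK_out {g : ℕ} {c : ℤ → ℝ} (hc : Hyp g c) {P : ℝ × ℝ} (h : P ∉ Gam g c) :
    KK (Gam g c) P 0 0 := by
  have hm : LocalModel (Gam g c) P (fun _ => False) := by
    refine ⟨?_, fun _ _ _ => Iff.rfl⟩
    have hcont : Tendsto (fun w : ℝ × ℝ => P + w) (𝓝 0) (𝓝 P) := by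
      have : Continuous fun w : ℝ × ℝ => P + w := by fun_prop
      simpa using this.tendsto 0
    filter_upwards [hcont.eventually ((Gam_closed hc).isOpen_compl.mem_nhds h)] with w hw
    simpa using hw
  have := KK_of_finset (S := Gam g c) (P := P) ∅ (by rw [localDirs_eq hm]; simp)
  simpa using this

lemma KK_other {g : ℕ} {c : ℤ → ℝ} (hc : Hyp g c) (hg : 0 < g) {P : ℝ × ℝ}
    (n1 : P ≠ W g c 0) (n2 : P ≠ conj c (W g c 0)) (n3 : P ≠ W g c g)
    (n4 : P ≠ conj c (W g c g)) : KK (Gam g c) P 0 0 := by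
  by_cases hP : P ∈ Gam g c
  swap
  · exact KK_out hc hP
  have hP' := hP
  rw [mem_Gam hc] at hP
  obtain ⟨⟨s1, s2⟩, h⟩ := hP
  have hU := U_pos hc P.1
  rcases strip_cases s1 s2 with ⟨k, hk, hX⟩ | ⟨k, hk, hX1, hX2⟩
  · by_cases e1 : P.2 = Ptilde g c P.1
    · have hW : P = W g c k := Prod.ext hX (by rw [e1, hX]; rfl)
      have k0 : k ≠ 0 := by rintro rfl; exact n1 hW
      have kg : k ≠ g := by rintro rfl; exact n3 hW
      have := KK_W hc hg hk
      rw [← hW] at this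
      simpa [k0, kg] using this
    by_cases e2 : P.2 = c (-1) - Ptilde g c P.1
    · have hW : P = conj c (W g c k) := Prod.ext hX (by rw [e2, hX]; rfl)
      have k0 : k ≠ 0 := by rintro rfl; exact n2 hW
      have kg : k ≠ g := by rintro rfl; exact n4 hW
      have := KK_conj hc (KK_W hc hg hk)
      rw [← hW] at this
      simpa [k0, kg] using this
    rcases h with h | h | ⟨-, h1, h2⟩
    · exact absurd h e1
    · exact absurd h e2
    · exact KK_vertical hc hk hX (lt_of_le_of_ne h1 (Ne.symm e2)) (lt_of_le_of_ne h2 e1)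
  · rcases h with h | h | ⟨⟨j, hj, he⟩, -⟩
    · exact KK_edge hc hk hX1 hX2 h
    · have := KK_conj hc (KK_edge hc hk (P := conj c P) hX1 hX2 (by simp [conj, h]))
      rw [conj_conj] at this
      simpa using this
    · exfalso
      rcases Nat.lt_or_ge k j with hjk | hjk
      · have := bk_le hc hjk hj; linarith
      · have := bk_le hc hjk hk.le; linarith

lemma W_ne_conj {g : ℕ} {c : ℤ → ℝ} (hc : Hyp g c) (j k : ℕ) (h : bk c j = bk c k) :
    W g c j ≠ conj c (W g c k) := by
  intro he
  have := congrArg Prod.snd he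
  simp only [W, conj, h] at this
  have := U_pos hc (bk c k)
  linarith

lemma KK_all {g : ℕ} {c : ℤ → ℝ} (hc : Hyp g c) (hg : 0 < g) (P : ℝ × ℝ) :
    KK (Gam g c) P
      ((Finsupp.single (W g c 0) (1 : ℤ) + Finsupp.single (conj c (W g c 0)) (1 : ℤ)
        - Finsupp.single (W g c g) (1 : ℤ) - Finsupp.single (conj c (W g c g)) (1 : ℤ) : Div) P)
      ((((g : ℤ) + 1) • (Finsupp.single (conj c (W g c g)) (1 : ℤ)
        - Finsupp.single (W g c g) (1 : ℤ)) : Div) P) := by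
  classical
  have hlt := bk_lt hc hg le_rfl
  have d1 : W g c 0 ≠ conj c (W g c 0) := W_ne_conj hc _ _ rfl
  have d2 : W g c g ≠ conj c (W g c g) := W_ne_conj hc _ _ rfl
  have d3 : W g c 0 ≠ W g c g := fun h => hlt.ne (congrArg Prod.fst h)
  have d4 : W g c 0 ≠ conj c (W g c g) := fun h => hlt.ne (congrArg Prod.fst h)
  have d5 : conj c (W g c 0) ≠ W g c g := fun h => hlt.ne (congrArg Prod.fst h)
  have d6 : conj c (W g c 0) ≠ conj c (W g c g) := fun h => hlt.ne (congrArg Prod.fst h)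
  have k0 := KK_W hc hg (Nat.zero_le g)
  have kg := KK_W hc hg (le_refl g)
  simp only [hg.ne, hg.ne', if_true, if_false] at k0 kg
  have k0' := KK_conj hc k0
  have kg' := KK_conj hc kg
  by_cases n1 : P = W g c 0
  · subst n1; simpa [Finsupp.single_apply, d1, d3, d4, d1.symm, d3.symm, d4.symm] using k0
  by_cases n2 : P = conj c (W g c 0)
  · subst n2; simpa [Finsupp.single_apply, d1, d5, d6, d1.symm, d5.symm, d6.symm] using k0'
  by_cases n3 : P = W g c g
  · subst n3; simpa [Finsupp.single_apply, d2, d3, d5, d2.symm, d3.symm, d5.symm] using kg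
  by_cases n4 : P = conj c (W g c g)
  · subst n4; simpa [Finsupp.single_apply, d2, d4, d6, d2.symm, d4.symm, d6.symm] using kg'
  have := KK_other hc hg n1 n2 n3 n4
  simpa [Finsupp.single_apply, Ne.symm n1, Ne.symm n2, Ne.symm n3, Ne.symm n4] using this

end TropicalHyperelliptic

namespace TropicalHyperelliptic

open Filter Topology

lemma V_zero {g : ℕ} {c : ℤ → ℝ} (hc : Hyp g c) : V g c 0 = W g c g := by
  have h := bk_g hc
  have h1 := U_bk hc (le_refl g)
  obtain ⟨h2, h3, -⟩ := hc
  rw [h] at h1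
  ext
  · simp [V, W, h, h2, h3]
  · simp [V, W, h, h1, h2, h3]

lemma V_g {g : ℕ} {c : ℤ → ℝ} (hc : Hyp g c) : V g c g = W g c 0 := by
  have h1 := U_bk hc (Nat.zero_le g)
  ext
  · simp [V, W, bk]
  · simp [V, W, h1]

lemma slope_unique {S : Set (ℝ × ℝ)} {f : ℝ × ℝ → ℝ} {P : ℝ × ℝ} {v : ℤ × ℤ} {s s' : ℤ}
    (hv : v ∈ localDirs S P) (h : HasSlope S f P v s) (h' : HasSlope S f P v s') : s = s' := by
  obtain ⟨-, ε, hε, hS⟩ := hv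
  obtain ⟨a, ha, h⟩ := h
  obtain ⟨b, hb, h'⟩ := h'
  have hm : 0 < min ε (min a b) / 2 := by positivity
  have hlt : min ε (min a b) / 2 < min ε (min a b) := by linarith
  have l1 := min_le_left ε (min a b)
  have l2 := (min_le_right ε (min a b)).trans (min_le_left a b)
  have l3 := (min_le_right ε (min a b)).trans (min_le_right a b)
  set t := min ε (min a b) / 2
  have hmem := hS t hm (by linarith)
  have e1 := h t hm.le (by linarith) hmem
  have e2 := h' t hm.le (by linarith) hmem
  have : (s : ℝ) * t = s' * t := by linarith
  exact_mod_cast mul_right_cancel₀ hm.ne' this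

lemma slope_eq {S : Set (ℝ × ℝ)} {f : ℝ × ℝ → ℝ} {P : ℝ × ℝ} {v : ℤ × ℤ} {s : ℤ}
    (hv : v ∈ localDirs S P) (h : HasSlope S f P v s) : slope S f P v = s := by
  have hex : ∃ s : ℤ, HasSlope S f P v s := ⟨s, h⟩
  unfold slope
  rw [dif_pos hex]
  exact slope_unique hv hex.choose_spec h

lemma ord_eq {S : Set (ℝ × ℝ)} {f : ℝ × ℝ → ℝ} {P : ℝ × ℝ} {σ : ℤ × ℤ → ℤ}
    (h : ∀ v ∈ localDirs S P, HasSlope S f P v (σ v)) :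
    ord S f P = ∑ᶠ v ∈ localDirs S P, σ v :=
  finsum_mem_congr rfl fun v hv => slope_eq hv (h v hv)

lemma sum_lin {S : Set (ℝ × ℝ)} {P : ℝ × ℝ} {A B : ℤ} (hK : KK S P A B) (m n : ℤ) :
    ∑ᶠ v ∈ localDirs S P, (m * v.1 + n * v.2) = m * A + n * B := by
  obtain ⟨hf, rfl, rfl⟩ := hK
  rw [finsum_mem_eq_finite_toFinset_sum _ hf, finsum_mem_eq_finite_toFinset_sum _ hf,
    finsum_mem_eq_finite_toFinset_sum _ hf, Finset.sum_add_distrib, Finset.mul_sum, Finset.mul_sum]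

lemma ord_affine {S : Set (ℝ × ℝ)} {f : ℝ × ℝ → ℝ} {P : ℝ × ℝ} {A B : ℤ} (hK : KK S P A B)
    {m n : ℤ} (h : ∀ v ∈ localDirs S P, HasSlope S f P v (m * v.1 + n * v.2)) :
    ord S f P = m * A + n * B := by
  rw [ord_eq h, sum_lin hK]

lemma hasSlope_affine (S : Set (ℝ × ℝ)) (P : ℝ × ℝ) (v : ℤ × ℤ) (a : ℝ) (m n : ℤ) :
    HasSlope S (fun p => a + ((m : ℝ) * p.1 + (n : ℝ) * p.2)) P v (m * v.1 + n * v.2) := by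
  refine ⟨1, one_pos, fun t _ _ _ => ?_⟩
  simp [vr]
  ring

lemma hasSlope_congr {S : Set (ℝ × ℝ)} {f h : ℝ × ℝ → ℝ} {P : ℝ × ℝ} {v : ℤ × ℤ} {s : ℤ}
    (hP : P ∈ S) (he : ∀ Q ∈ S, f Q = h Q) (hs : HasSlope S h P v s) : HasSlope S f P v s := by
  obtain ⟨ε, hε, hs⟩ := hs
  refine ⟨ε, hε, fun t h0 h1 hm => ?_⟩
  rw [he _ hm, he _ hP, hs t h0 h1 hm]

lemma hasSlope_max {S : Set (ℝ × ℝ)} {f h : ℝ × ℝ → ℝ} {P : ℝ × ℝ} {v : ℤ × ℤ} {s t : ℤ}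
    (hle : h P ≤ f P) (hs : HasSlope S f P v s) (ht : HasSlope S h P v t) :
    ∃ r, s ≤ r ∧ HasSlope S (fun p => max (f p) (h p)) P v r := by
  obtain ⟨ε, hε, hs⟩ := hs
  obtain ⟨δ, hδ, ht⟩ := ht
  rcases hle.eq_or_lt with he | hlt
  · refine ⟨max s t, le_max_left _ _, min ε δ, by positivity, fun u h0 h1 hm => ?_⟩
    beta_reduce
    rw [hs u h0 (h1.trans_le (min_le_left _ _)) hm, ht u h0 (h1.trans_le (min_le_right _ _)) hm,
      he, max_self, max_add_add_left]
    push_cast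
    rw [max_mul_of_nonneg _ _ h0]
  · have hev : ∀ᶠ u in 𝓝 (0 : ℝ), h P + t * u < f P + s * u :=
      (isOpen_lt (by fun_prop) (by fun_prop)).mem_nhds (by simpa using hlt)
    obtain ⟨η, hη, hev⟩ := Metric.eventually_nhds_iff.mp hev
    refine ⟨s, le_rfl, min η (min ε δ), by positivity, fun u h0 h1 hm => ?_⟩
    have l1 := min_le_left η (min ε δ)
    have l2 := (min_le_right η (min ε δ)).trans (min_le_left ε δ)
    have l3 := (min_le_right η (min ε δ)).trans (min_le_right ε δ)
    have := hev (y := u) (by rw [Real.dist_eq, sub_zero, abs_of_nonneg h0]; linarith)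
    beta_reduce
    rw [hs u h0 (by linarith) hm, ht u h0 (by linarith) hm, max_eq_left hlt.le, max_eq_left this.le]

/-- Integer slopes exist at `P`, and they dominate those of a monomial of order `≥ -D P`. -/
def Good (S : Set (ℝ × ℝ)) (D : Div) (f : ℝ × ℝ → ℝ) (P : ℝ × ℝ) : Prop :=
  ∃ m n : ℤ, (∀ v ∈ localDirs S P, ∃ s, m * v.1 + n * v.2 ≤ s ∧ HasSlope S f P v s) ∧
    0 ≤ m * (∑ᶠ v ∈ localDirs S P, v.1) + n * (∑ᶠ v ∈ localDirs S P, v.2) + D P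

lemma Good_max' {S : Set (ℝ × ℝ)} {D : Div} {f h : ℝ × ℝ → ℝ} {P : ℝ × ℝ} (hle : h P ≤ f P)
    (hf : Good S D f P) (hh : ∀ v ∈ localDirs S P, ∃ s, HasSlope S h P v s) :
    Good S D (fun p => max (f p) (h p)) P := by
  obtain ⟨m, n, h1, h2⟩ := hf
  refine ⟨m, n, fun v hv => ?_, h2⟩
  obtain ⟨s, hs, hs'⟩ := h1 v hv
  obtain ⟨t, ht⟩ := hh v hv
  obtain ⟨r, hr, hr'⟩ := hasSlope_max hle hs' ht
  exact ⟨r, hs.trans hr, hr'⟩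

lemma Good_slopes {S : Set (ℝ × ℝ)} {D : Div} {f : ℝ × ℝ → ℝ} {P : ℝ × ℝ}
    (hf : Good S D f P) : ∀ v ∈ localDirs S P, ∃ s, HasSlope S f P v s := by
  obtain ⟨m, n, h1, h2⟩ := hf
  intro v hv
  obtain ⟨s, -, hs⟩ := h1 v hv
  exact ⟨s, hs⟩

lemma Good_max {S : Set (ℝ × ℝ)} {D : Div} {f h : ℝ × ℝ → ℝ} {P : ℝ × ℝ}
    (hf : Good S D f P) (hh : Good S D h P) : Good S D (fun p => max (f p) (h p)) P := by
  rcases le_total (h P) (f P) with hle | hle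
  · exact Good_max' hle hf (Good_slopes hh)
  · have := Good_max' hle hh (Good_slopes hf)
    simpa only [max_comm] using this

lemma mem_RSet {S : Set (ℝ × ℝ)} {D : Div} {f : ℝ × ℝ → ℝ} (hc : ContinuousOn f S)
    (hfin : ∀ P, (localDirs S P).Finite) (hf : ∀ P ∈ S, Good S D f P) : f ∈ RSet S D := by
  refine ⟨⟨hc, fun P hP v hv => Good_slopes (hf P hP) v hv⟩, fun P hP => ?_⟩
  obtain ⟨m, n, h1, h2⟩ := hf P hP
  choose! σ hσ1 hσ2 using h1
  rw [ord_eq hσ2]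
  refine h2.trans (add_le_add_left ?_ _)
  rw [← sum_lin ⟨hfin P, rfl, rfl⟩, finsum_mem_eq_finite_toFinset_sum _ (hfin P),
    finsum_mem_eq_finite_toFinset_sum _ (hfin P)]
  exact Finset.sum_le_sum fun v hv => hσ1 v (by simpa using hv)

lemma Good_affine {S : Set (ℝ × ℝ)} {D : Div} {P : ℝ × ℝ} (a : ℝ) (m n : ℤ)
    (h : 0 ≤ m * (∑ᶠ v ∈ localDirs S P, v.1) + n * (∑ᶠ v ∈ localDirs S P, v.2) + D P) :
    Good S D (fun p => a + ((m : ℝ) * p.1 + (n : ℝ) * p.2)) P :=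
  ⟨m, n, fun v _ => ⟨_, le_rfl, hasSlope_affine S P v a m n⟩, h⟩

/-- Extended tropical functions: identically `⊥`, identically `⊤`, or real and good. -/
def EGood (S : Set (ℝ × ℝ)) (D : Div) (F : ℝ × ℝ → EReal) : Prop :=
  (∀ P, F P = ⊥) ∨ (∀ P, F P = ⊤) ∨
    ∃ h : ℝ × ℝ → ℝ, Continuous h ∧ (∀ P, Good S D h P) ∧ ∀ P, F P = (h P : EReal)

lemma EGood_max {S : Set (ℝ × ℝ)} {D : Div} {F G : ℝ × ℝ → EReal} (hF : EGood S D F)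
    (hG : EGood S D G) : EGood S D (fun P => max (F P) (G P)) := by
  rcases hF with hF | hF | ⟨f, f1, f2, f3⟩
  · simpa only [EGood, hF, bot_le, max_eq_right] using hG
  · right; left; intro P; simp [hF]
  rcases hG with hG | hG | ⟨h, h1, h2, h3⟩
  · right; right; exact ⟨f, f1, f2, fun P => by simp [hG, f3]⟩
  · right; left; intro P; simp [hG]
  · right; right
    exact ⟨fun P => max (f P) (h P), f1.max h1, fun P => Good_max (f2 P) (h2 P),
      fun P => by beta_reduce; rw [f3, h3]; exact (EReal.coe_strictMono.monotone.map_max).symm⟩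

lemma EGood_sup {S : Set (ℝ × ℝ)} {D : Div} (s : Finset ℕ) (F : ℕ → ℝ × ℝ → EReal)
    (h : ∀ i ∈ s, EGood S D (F i)) : EGood S D (fun P => s.sup fun i => F i P) := by
  classical
  induction s using Finset.induction_on with
  | empty => left; intro P; simp
  | insert a s ha ih =>
    simp only [Finset.sup_insert]
    exact EGood_max (h a (Finset.mem_insert_self _ _))
      (ih fun i hi => h i (Finset.mem_insert_of_mem hi))

lemma EGood_term {S : Set (ℝ × ℝ)} {D : Div} (a : EReal) (m n : ℤ)
    (h : ∀ P, 0 ≤ m * (∑ᶠ v ∈ localDirs S P, v.1) + n * (∑ᶠ v ∈ localDirs S P, v.2) + D P) :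
    EGood S D (fun P => a + (((m : ℝ) * P.1 + (n : ℝ) * P.2 : ℝ) : EReal)) := by
  induction a using EReal.rec with
  | bot => left; intro P; simp
  | top => right; left; intro P; exact EReal.top_add_coe _
  | coe a =>
    right; right
    exact ⟨fun p => a + ((m : ℝ) * p.1 + (n : ℝ) * p.2), by fun_prop,
      fun P => Good_affine a m n (h P), fun P => (EReal.coe_add _ _).symm⟩

/-- The sums of outgoing directions in the form used below. -/
lemma sums {g m : ℕ} {c : ℤ → ℝ} (hm : g = 2 * m + 1) (hc : Hyp g c) (P : ℝ × ℝ) :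
    ∃ e1 e2 e3 e4 : ℤ, 0 ≤ e1 ∧ 0 ≤ e2 ∧ 0 ≤ e3 ∧ 0 ≤ e4 ∧
      Finsupp.single (V g c g) (1 : ℤ) P = e1 ∧ Finsupp.single (conj c (V g c g)) (1 : ℤ) P = e2 ∧
      Finsupp.single (V g c 0) (1 : ℤ) P = e3 ∧ Finsupp.single (conj c (V g c 0)) (1 : ℤ) P = e4 ∧
      KK (Gam g c) P (e1 + e2 - e3 - e4) ((2 * m + 2) * (e4 - e3)) ∧
      (3 • DstarOdd g c) P = 3 * (m * (e3 + e4) + e3) := by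
  classical
  have hnn : ∀ Q : ℝ × ℝ, 0 ≤ Finsupp.single Q (1 : ℤ) P := by
    intro Q; rw [Finsupp.single_apply]; split_ifs <;> norm_num
  refine ⟨_, _, _, _, hnn _, hnn _, hnn _, hnn _, rfl, rfl, rfl, rfl, ?_, ?_⟩
  · have := KK_all hc (by omega) P
    rw [← V_zero hc, ← V_g hc] at this
    rw [Finsupp.smul_apply, Finsupp.sub_apply, Finsupp.sub_apply, Finsupp.sub_apply,
      Finsupp.add_apply, smul_eq_mul] at this
    have hg2 : (g : ℤ) + 1 = 2 * m + 2 := by omega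
    rw [hg2] at this
    exact this
  · have : (g - 1) / 2 = m := by omega
    unfold DstarOdd
    rw [this]
    simp only [Finsupp.smul_apply, Finsupp.add_apply, smul_eq_mul, nsmul_eq_mul]
    norm_num

lemma U_slopes {g : ℕ} {c : ℤ → ℝ} {S : Set (ℝ × ℝ)} (P : ℝ × ℝ) (v : ℤ × ℤ) :
    ∃ s, HasSlope S (fun p => Ptilde g c p.1) P v s := by
  have key : ∀ (s : Finset ℕ) (hs : s.Nonempty),
      ∃ r, HasSlope S (fun p => s.sup' hs fun i => c (i : ℤ) + (i : ℝ) * p.1) P v r := by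
    intro s hs
    induction hs using Finset.Nonempty.cons_induction with
    | singleton a =>
      have := hasSlope_affine S P v (c a) a 0
      simp only [Finset.sup'_singleton]
      exact ⟨_, by simpa using this⟩
    | cons a s ha hs ih =>
      obtain ⟨r, hr⟩ := ih
      have h1 : HasSlope S (fun p => c (a : ℤ) + (a : ℝ) * p.1) P v ((a : ℤ) * v.1 + 0 * v.2) := by
        simpa using hasSlope_affine S P v (c a) a 0
      simp only [Finset.sup'_cons hs]
      rcases le_total (c (a : ℤ) + (a : ℝ) * P.1)
          (s.sup' hs fun i => c (i : ℤ) + (i : ℝ) * P.1) with hle | hle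
      · obtain ⟨q, -, hq⟩ := hasSlope_max hle hr h1
        exact ⟨q, by simpa only [max_comm] using hq⟩
      · obtain ⟨q, -, hq⟩ := hasSlope_max hle h1 hr
        exact ⟨q, hq⟩
  exact key _ _

/-- The auxiliary function for the witness. -/
noncomputable def h0 (g : ℕ) (c : ℤ → ℝ) (ε : ℝ) (p : ℝ × ℝ) : ℝ :=
  ε + p.1 + 2 * p.2 - 2 * Ptilde g c p.1

lemma h0_slopes {g : ℕ} {c : ℤ → ℝ} {S : Set (ℝ × ℝ)} (ε : ℝ) (P : ℝ × ℝ) (v : ℤ × ℤ) :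
    ∃ s, HasSlope S (h0 g c ε) P v s := by
  obtain ⟨s, δ, hδ, h⟩ := U_slopes (g := g) (c := c) (S := S) P v
  refine ⟨v.1 + 2 * v.2 - 2 * s, δ, hδ, fun t h1 h2 h3 => ?_⟩
  have := h t h1 h2 h3
  beta_reduce at this
  unfold h0
  rw [this]
  simp [vr]
  ring

lemma h0_slope_near {g : ℕ} {c : ℤ → ℝ} (hc : Hyp g c) (hg : 0 < g) (ε : ℝ) {P : ℝ × ℝ}
    (hP : P ∈ Gam g c) (hX : bk c (g - 1) < P.1) (v : ℤ × ℤ) :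
    HasSlope (Gam g c) (h0 g c ε) P v ((1 - 2 * (g : ℤ)) * v.1 + 2 * v.2) := by
  have hU : ∀ Q ∈ Gam g c, bk c (g - 1) < Q.1 → Ptilde g c Q.1 = g * Q.1 := by
    intro Q hQ hlt
    rw [mem_Gam hc] at hQ
    have hgg : g - 1 + 1 = g := by omega
    have := U_mid hc (k := g - 1) (by omega) hlt.le (by rw [hgg]; exact hQ.1.2)
    rw [hgg, hc.2.1] at this
    simpa using this
  have hev : ∀ᶠ t in 𝓝 (0 : ℝ), bk c (g - 1) < P.1 + t * v.1 :=
    (isOpen_lt (by fun_prop) (by fun_prop)).mem_nhds (by simpa using hX)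
  obtain ⟨η, hη, hev⟩ := Metric.eventually_nhds_iff.mp hev
  refine ⟨η, hη, fun t h1 h2 h3 => ?_⟩
  have := hev (y := t) (by rw [Real.dist_eq, sub_zero, abs_of_nonneg h1]; exact h2)
  have e1 := hU _ h3 (by simpa [vr] using this)
  have e2 := hU _ hP hX
  unfold h0
  rw [e1, e2]
  simp [vr]
  ring

end TropicalHyperelliptic

namespace TropicalHyperelliptic

open Filter Topology

lemma part1 {g m : ℕ} {c : ℤ → ℝ} (hm : g = 2 * m + 1) (hc : Hyp g c) (f : ℝ × ℝ → ℝ)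
    (hf : InMgOdd g c f) : f ∈ RSet (Gam g c) (3 • DstarOdd g c) := by
  obtain ⟨a, b, hab⟩ := hf
  have hA : ∀ i ∈ Finset.range (3 * (g - 1) / 2 + 1), EGood (Gam g c) (3 • DstarOdd g c)
      (fun P => a i + (((i : ℝ) * P.1 : ℝ) : EReal)) := by
    intro i hi
    have hi' : i ≤ 3 * m := by rw [Finset.mem_range] at hi; omega
    have := EGood_term (S := Gam g c) (D := 3 • DstarOdd g c) (a i) i 0 (by
      intro P
      obtain ⟨e1, e2, e3, e4, p1, p2, p3, p4, -, -, -, -, ⟨-, k1, k2⟩, hD⟩ := sums hm hc P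
      rw [k1, k2, hD]
      obtain ⟨r, hr⟩ := Nat.exists_eq_add_of_le hi'
      have hr' : (3 * m : ℤ) = i + r := by exact_mod_cast hr
      have : (i : ℤ) * (e1 + e2 - e3 - e4) + 0 * ((2 * m + 2) * (e4 - e3))
        + 3 * (m * (e3 + e4) + e3) = i * (e1 + e2) + r * (e3 + e4) + 3 * e3 := by
        linear_combination (e3 + e4) * hr'
      rw [this]; positivity)
    simpa using this
  have hB : ∀ i ∈ Finset.range ((g + 1) / 2 + 1), EGood (Gam g c) (3 • DstarOdd g c)
      (fun P => b i + (((i : ℝ) * P.1 + P.2 : ℝ) : EReal)) := by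
    intro i hi
    have hi' : i ≤ m + 1 := by rw [Finset.mem_range] at hi; omega
    have := EGood_term (S := Gam g c) (D := 3 • DstarOdd g c) (b i) i 1 (by
      intro P
      obtain ⟨e1, e2, e3, e4, p1, p2, p3, p4, -, -, -, -, ⟨-, k1, k2⟩, hD⟩ := sums hm hc P
      rw [k1, k2, hD]
      obtain ⟨r, hr⟩ := Nat.exists_eq_add_of_le hi'
      have hr' : (m + 1 : ℤ) = i + r := by exact_mod_cast hr
      have : (i : ℤ) * (e1 + e2 - e3 - e4) + 1 * ((2 * m + 2) * (e4 - e3))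
        + 3 * (m * (e3 + e4) + e3) = i * (e1 + e2) + r * e3 + (r + 4 * m + 1) * e4 := by
        linear_combination (e3 + e4) * hr'
      rw [this]; positivity)
    simpa using this
  have hfin : ∀ P, (localDirs (Gam g c) P).Finite := fun P => (KK_all hc (by omega) P).1
  have hne : W g c g ∈ Gam g c := by
    rw [mem_Gam hc]
    exact ⟨⟨bk_le hc (Nat.zero_le _) le_rfl, le_rfl⟩, Or.inl rfl⟩
  rcases EGood_max (EGood_sup _ _ hA) (EGood_sup _ _ hB) with h | h | ⟨h, h1, h2, h3⟩
  · have := (hab _ hne).trans (h _)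
    exact absurd this (EReal.coe_ne_bot _)
  · have := (hab _ hne).trans (h _)
    exact absurd this (EReal.coe_ne_top _)
  · have he : ∀ Q ∈ Gam g c, f Q = h Q := by
      intro Q hQ
      exact_mod_cast (hab Q hQ).trans (h3 Q)
    refine mem_RSet (h1.continuousOn.congr he) hfin fun P hP => ?_
    obtain ⟨m, n, q1, q2⟩ := h2 P
    refine ⟨m, n, fun v hv => ?_, q2⟩
    obtain ⟨s, hs, hs'⟩ := q1 v hv
    exact ⟨s, hs, hasSlope_congr hP he hs'⟩

lemma part2 {g m : ℕ} {c : ℤ → ℝ} (hm : g = 2 * m + 1) (hm1 : 1 ≤ m) (hc : Hyp g c) :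
    ∃ f ∈ RSet (Gam g c) (3 • DstarOdd g c), ¬ InMgOdd g c f := by
  have hbg := bk_g hc
  have hU0 : Ptilde g c 0 = 0 := by
    have := U_bk hc (le_refl g)
    rw [hbg, hc.2.1] at this
    simpa using this
  have hC : c (-1) < 0 := by have := U_pos hc 0; linarith
  have hb1 : bk c (g - 1) < 0 := by rw [← hbg]; exact bk_lt hc (by omega) le_rfl
  have hb0 : bk c 0 ≤ bk c (g - 1) := bk_le hc (Nat.zero_le _) (by omega)
  obtain ⟨ε, hε, hε1, hε2⟩ : ∃ ε : ℝ, 0 < ε ∧ ε ≤ -bk c (g - 1) ∧ ε ≤ -c (-1) :=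
    ⟨min (-bk c (g - 1)) (-c (-1)), lt_min (by linarith) (by linarith), min_le_left _ _,
      min_le_right _ _⟩
  have hUc := U_cont g c
  refine ⟨fun p => max 0 (h0 g c ε p), mem_RSet ?_ (fun P => (KK_all hc (by omega) P).1) ?_, ?_⟩
  · apply Continuous.continuousOn
    unfold h0
    fun_prop
  · intro P hP
    obtain ⟨e1, e2, e3, e4, p1, p2, p3, p4, d1, d2, d3, d4, ⟨-, k1, k2⟩, hD⟩ := sums hm hc P
    have hz : ∀ v ∈ localDirs (Gam g c) P, HasSlope (Gam g c) (fun _ => (0 : ℝ)) P v 0 :=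
      fun v _ => ⟨1, one_pos, fun t _ _ _ => by simp⟩
    rcases le_or_gt (h0 g c ε P) 0 with hle | hgt
    · refine Good_max' (f := fun _ => (0 : ℝ)) hle ⟨0, 0, fun v hv => ⟨0, by simp, hz v hv⟩, ?_⟩
        (fun v _ => h0_slopes ε P v)
      rw [hD]
      simp only [zero_mul, zero_add]
      positivity
    · have hY : P.2 ≤ Ptilde g c P.1 := by
        have hU := U_pos hc P.1
        have h := ((mem_Gam hc P).mp hP).2
        rcases h with h | h | ⟨-, -, h⟩ <;> linarith
      have hX : -ε < P.1 := by unfold h0 at hgt; linarith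
      have n1 : e1 = 0 := by
        rw [← d1, Finsupp.single_apply, if_neg]
        rw [V_g hc]; rintro rfl
        simp only [W] at hX; linarith
      have n2 : e2 = 0 := by
        rw [← d2, Finsupp.single_apply, if_neg]
        rw [V_g hc]; rintro rfl
        simp only [W, conj] at hX; linarith
      have n4 : e4 = 0 := by
        rw [← d4, Finsupp.single_apply, if_neg]
        rw [V_zero hc]; rintro rfl
        simp only [h0, W, conj, hbg, hU0] at hgt; linarith
      have hG : Good (Gam g c) (3 • DstarOdd g c) (h0 g c ε) P := by
        refine ⟨1 - 2 * g, 2, fun v hv => ⟨_, le_rfl,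
          h0_slope_near hc (by omega) ε hP (by linarith) v⟩, ?_⟩
        rw [k1, k2, hD, n1, n2, n4]
        have : (1 - 2 * (g : ℤ)) * (0 + 0 - e3 - 0) + 2 * ((2 * m + 2) * (0 - e3))
          + 3 * (m * (e3 + 0) + e3) = 3 * (m - 1) * e3 + 3 * e3 := by
          rw [hm]; push_cast; ring
        rw [this]
        have : (0 : ℤ) ≤ m - 1 := by omega
        positivity
      have := Good_max' (h := fun _ => (0 : ℝ)) hgt.le hG (fun v hv => ⟨0, hz v hv⟩)
      simpa only [max_comm] using this
  · rintro ⟨a, b, hab⟩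
    have m1 : ((0 : ℝ), (0 : ℝ)) ∈ Gam g c := by
      rw [mem_Gam hc]
      exact ⟨⟨by simp only; linarith, hbg.ge⟩, Or.inl hU0.symm⟩
    have m2 : ((0 : ℝ), -(ε / 2)) ∈ Gam g c := by
      rw [mem_Gam hc]
      simp only [hU0]
      exact ⟨⟨by linarith, hbg.ge⟩, Or.inr (Or.inr ⟨⟨g, le_rfl, hbg.symm⟩, by linarith,
        by linarith⟩)⟩
    have v1 := hab _ m1
    have v2 := hab _ m2
    have w1 : max 0 (h0 g c ε (0, 0)) = ε := by
      simp [h0, hU0, hε.le]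
    have w2 : max 0 (h0 g c ε (0, -(ε / 2))) = 0 := by
      simp [h0, hU0]
      linarith
    beta_reduce at v1 v2
    rw [w1] at v1
    rw [w2] at v2
    have v3 := max_le_iff.mp v2.ge
    rcases max_choice ((Finset.range (3 * (g - 1) / 2 + 1)).sup
            fun i => a i + (((i : ℝ) * (0 : ℝ) : ℝ) : EReal))
          ((Finset.range ((g + 1) / 2 + 1)).sup
            fun i => b i + (((i : ℝ) * (0 : ℝ) + (0 : ℝ) : ℝ) : EReal)) with hmx | hmx
    · rw [hmx] at v1
      rw [← v1] at v3
      have : ε ≤ 0 := by exact_mod_cast v3.1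
      linarith
    · rw [hmx] at v1
      obtain ⟨i, hi, hi'⟩ := Finset.exists_mem_eq_sup (Finset.range ((g + 1) / 2 + 1))
        ⟨0, by simp⟩ (fun i => b i + (((i : ℝ) * (0 : ℝ) + (0 : ℝ) : ℝ) : EReal))
      rw [hi'] at v1
      have hb : b i = (ε : EReal) := by simpa using v1.symm
      have hle := (Finset.le_sup (f := fun i => b i +
        (((i : ℝ) * (0 : ℝ) + -(ε / 2) : ℝ) : EReal)) hi).trans v3.2
      simp only [hb] at hle
      rw [← EReal.coe_add] at hle
      have : ε + ((i : ℝ) * 0 + -(ε / 2)) ≤ 0 := by exact_mod_cast hle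
      linarith

lemma V_distinct {g : ℕ} {c : ℤ → ℝ} (hc : Hyp g c) (hg : 0 < g) :
    V g c 0 ≠ conj c (V g c 0) ∧ V g c g ≠ V g c 0 ∧ V g c g ≠ conj c (V g c 0) ∧
      conj c (V g c g) ≠ V g c 0 ∧ conj c (V g c g) ≠ conj c (V g c 0) := by
  have hlt := bk_lt hc hg le_rfl
  rw [V_zero hc, V_g hc]
  exact ⟨W_ne_conj hc _ _ rfl, fun h => hlt.ne (congrArg Prod.fst h),
    fun h => hlt.ne (congrArg Prod.fst h), fun h => hlt.ne (congrArg Prod.fst h),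
    fun h => hlt.ne (congrArg Prod.fst h)⟩

lemma Eff_iff {g : ℕ} {c : ℤ → ℝ} (hc : Hyp g c) (hg : 0 < g) (i : ℕ) (p q : ℤ) :
    Eff ((i : ℤ) • (Finsupp.single (V g c g) (1 : ℤ) + Finsupp.single (conj c (V g c g)) (1 : ℤ))
      + p • Finsupp.single (V g c 0) (1 : ℤ) + q • Finsupp.single (conj c (V g c 0)) (1 : ℤ)) ↔
    0 ≤ p ∧ 0 ≤ q := by
  classical
  obtain ⟨d1, d2, d3, d4, d5⟩ := V_distinct hc hg
  constructor
  · intro h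
    have h1 := h (V g c 0)
    have h2 := h (conj c (V g c 0))
    simp only [Finsupp.add_apply, Finsupp.smul_apply, Finsupp.single_apply, d1, d1.symm, d2, d3,
      d4, d5, if_true, if_false, smul_eq_mul] at h1 h2
    constructor
    · simpa using h1
    · simpa using h2
  · rintro ⟨hp, hq⟩ P
    have hnn : ∀ Q : ℝ × ℝ, 0 ≤ Finsupp.single Q (1 : ℤ) P := by
      intro Q; rw [Finsupp.single_apply]; split_ifs <;> norm_num
    have h1 := hnn (V g c g)
    have h2 := hnn (conj c (V g c g))
    have h3 := hnn (V g c 0)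
    have h4 := hnn (conj c (V g c 0))
    simp only [Finsupp.add_apply, Finsupp.smul_apply, smul_eq_mul]
    positivity

end TropicalHyperelliptic


/-- Let `g` be odd with `g ≥ 3`, `Γ` the bounded part of the tropical
hyperelliptic curve of genus `g`, and `D* = ((g−1)/2)(V_0 + V_0′) + V_0`.  The
tropical module `𝓜_g` is a proper subset of `R(3D*)`.  In particular
`(i·x) + 3D* = i(V_g + V_g′) + (3(g+1)/2 − i)V_0 + (3(g−1)/2 − i)V_0′` is
effective iff `0 ≤ i ≤ 3(g−1)/2`, and
`(i·x + y) + 3D* = i(V_g + V_g′) + ((g+1)/2 − i)V_0 + ((5g−1)/2 − i)V_0′` is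
effective iff `0 ≤ i ≤ (g+1)/2`. -/
theorem Mg_proper_subset_R_odd (g : ℕ) (c : ℤ → ℝ) (hg : Odd g) (hg3 : 3 ≤ g)
    (hc : Hyp g c) :
    (∀ f : (ℝ × ℝ) → ℝ, InMgOdd g c f → f ∈ RSet (Gam g c) (3 • DstarOdd g c))
    ∧ (∃ f ∈ RSet (Gam g c) (3 • DstarOdd g c), ¬ InMgOdd g c f)
    ∧ (∀ i : ℕ,
        (∀ P : ℝ × ℝ,
          ord (Gam g c) (fun p => (i : ℝ) * p.1) P + (3 • DstarOdd g c) P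
            = ((i : ℤ) • (Finsupp.single (V g c g) (1 : ℤ)
                  + Finsupp.single (conj c (V g c g)) (1 : ℤ))
                + (3 * ((g : ℤ) + 1) / 2 - (i : ℤ)) • Finsupp.single (V g c 0) (1 : ℤ)
                + (3 * ((g : ℤ) - 1) / 2 - (i : ℤ)) •
                    Finsupp.single (conj c (V g c 0)) (1 : ℤ)) P)
        ∧ (Eff ((i : ℤ) • (Finsupp.single (V g c g) (1 : ℤ)
                  + Finsupp.single (conj c (V g c g)) (1 : ℤ))
                + (3 * ((g : ℤ) + 1) / 2 - (i : ℤ)) • Finsupp.single (V g c 0) (1 : ℤ)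
                + (3 * ((g : ℤ) - 1) / 2 - (i : ℤ)) •
                    Finsupp.single (conj c (V g c 0)) (1 : ℤ))
            ↔ (i : ℤ) ≤ 3 * ((g : ℤ) - 1) / 2))
    ∧ (∀ i : ℕ,
        (∀ P : ℝ × ℝ,
          ord (Gam g c) (fun p => (i : ℝ) * p.1 + p.2) P + (3 • DstarOdd g c) P
            = ((i : ℤ) • (Finsupp.single (V g c g) (1 : ℤ)
                  + Finsupp.single (conj c (V g c g)) (1 : ℤ))
                + (((g : ℤ) + 1) / 2 - (i : ℤ)) • Finsupp.single (V g c 0) (1 : ℤ)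
                + ((5 * (g : ℤ) - 1) / 2 - (i : ℤ)) •
                    Finsupp.single (conj c (V g c 0)) (1 : ℤ)) P)
        ∧ (Eff ((i : ℤ) • (Finsupp.single (V g c g) (1 : ℤ)
                  + Finsupp.single (conj c (V g c g)) (1 : ℤ))
                + (((g : ℤ) + 1) / 2 - (i : ℤ)) • Finsupp.single (V g c 0) (1 : ℤ)
                + ((5 * (g : ℤ) - 1) / 2 - (i : ℤ)) •
                    Finsupp.single (conj c (V g c 0)) (1 : ℤ))
            ↔ (i : ℤ) ≤ ((g : ℤ) + 1) / 2)) := by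
  obtain ⟨m, hm⟩ := hg
  have hm1 : 1 ≤ m := by omega
  refine ⟨part1 hm hc, part2 hm hm1 hc, fun i => ⟨fun P => ?_, ?_⟩, fun i => ⟨fun P => ?_, ?_⟩⟩
  · obtain ⟨e1, e2, e3, e4, -, -, -, -, d1, d2, d3, d4, hK, hD⟩ := sums hm hc P
    have hs : ∀ v ∈ localDirs (Gam g c) P,
        HasSlope (Gam g c) (fun p => (i : ℝ) * p.1) P v ((i : ℤ) * v.1 + 0 * v.2) := by
      intro v _
      simpa using hasSlope_affine (Gam g c) P v 0 i 0
    rw [ord_affine hK hs, hD]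
    simp only [Finsupp.add_apply, Finsupp.smul_apply, smul_eq_mul, d1, d2, d3, d4]
    have t1 : 3 * ((g : ℤ) + 1) / 2 = 3 * m + 3 := by omega
    have t2 : 3 * ((g : ℤ) - 1) / 2 = 3 * m := by omega
    rw [t1, t2]
    ring
  · rw [Eff_iff hc (by omega)]
    omega
  · obtain ⟨e1, e2, e3, e4, -, -, -, -, d1, d2, d3, d4, hK, hD⟩ := sums hm hc P
    have hs : ∀ v ∈ localDirs (Gam g c) P,
        HasSlope (Gam g c) (fun p => (i : ℝ) * p.1 + p.2) P v ((i : ℤ) * v.1 + 1 * v.2) := by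
      intro v _
      simpa using hasSlope_affine (Gam g c) P v 0 i 1
    rw [ord_affine hK hs, hD]
    simp only [Finsupp.add_apply, Finsupp.smul_apply, smul_eq_mul, d1, d2, d3, d4]
    have t1 : ((g : ℤ) + 1) / 2 = m + 1 := by omega
    have t2 : (5 * (g : ℤ) - 1) / 2 = 5 * m + 2 := by omega
    rw [t1, t2]
    ring
  · rw [Eff_iff hc (by omega)]
    omega
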